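/- arXiv:2508.00488 — 2 statements merged into one kernel-verified Lean document; each statement's English description precedes it below -/
import Mathlib

section
/- Every element ξ ∈ V₊ with ξ ∉ V₊⁰ generates V₊ as a kG-module, i.e., kG·ξ = V₊. Consequently V₊⁰ is the unique maximal proper kG-submodule of V₊, and the trivial module k_tr is the unique simple quotient of V₊. -/
noncomputable section

open scoped TensorProduct

namespace SL2X

variable (p : ℕ) [Fact p.Prime]

/-- The algebraic closure of the prime field `𝔽_p`. -/
abbrev F : Type := AlgebraicClosure (ZMod p)

/-- `G = SL₂(F)`. -/
abbrev G : Type := Matrix.SpecialLinearGroup (Fin 2) (F p)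

/-- The unipotent element `ε(x) = [[1,x],[0,1]]`. -/
def eps (x : F p) : G p :=
  ⟨!![1, x; 0, 1], by simp [Matrix.det_fin_two_of]⟩

/-- The torus element `h(t) = diag(t, t⁻¹)`. -/
def h (t : (F p)ˣ) : G p :=
  ⟨!![(t : F p), 0; 0, ((t⁻¹ : (F p)ˣ) : F p)], by simp [Matrix.det_fin_two_of]⟩

/-- The Weyl element `s = [[0,1],[-1,0]]`. -/
def sG : G p :=
  ⟨!![0, 1; -1, 0], by simp [Matrix.det_fin_two_of]⟩

/-- The Borel subgroup `B` of upper triangular matrices in `G`. -/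
def B : Subgroup (G p) where
  carrier := {g | (g : Matrix (Fin 2) (Fin 2) (F p)) 1 0 = 0}
  one_mem' := by simp [Matrix.one_apply]
  mul_mem' := by
    intro a b ha hb
    simp only [Set.mem_setOf_eq] at *
    simp [Matrix.mul_apply, Fin.sum_univ_two, ha, hb]
  inv_mem' := by
    intro a ha
    simp only [Set.mem_setOf_eq] at *
    simp [Matrix.SpecialLinearGroup.coe_inv, Matrix.adjugate_fin_two, ha]

/-- The diagonal part of an element of `B`, as a unit of `F`. -/
def Bdiag (b : B p) : (F p)ˣ where
  val := ((b : G p) : Matrix (Fin 2) (Fin 2) (F p)) 0 0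
  inv := ((b : G p) : Matrix (Fin 2) (Fin 2) (F p)) 1 1
  val_inv := by
    have hdet : ((b : G p) : Matrix (Fin 2) (Fin 2) (F p)).det = 1 := (b : G p).2
    have h10 : ((b : G p) : Matrix (Fin 2) (Fin 2) (F p)) 1 0 = 0 := b.2
    rw [Matrix.det_fin_two, h10, mul_zero, sub_zero] at hdet
    exact hdet
  inv_val := by
    have hdet : ((b : G p) : Matrix (Fin 2) (Fin 2) (F p)).det = 1 := (b : G p).2
    have h10 : ((b : G p) : Matrix (Fin 2) (Fin 2) (F p)) 1 0 = 0 := b.2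
    rw [Matrix.det_fin_two, h10, mul_zero, sub_zero] at hdet
    rw [mul_comm]; exact hdet

variable (k : Type) [Field k] [IsAlgClosed k] [CharZero k]

/-- The group algebra `kG`. -/
abbrev kG : Type := MonoidAlgebra k (G p)

/-- The canonical image of a group element in the group algebra. -/
def γ (g : G p) : kG p k := MonoidAlgebra.of k (G p) g

/-- The submodule of relations defining the induced module
`M(θ) = kG ⊗_{kB} k_θ`, where the character `θ` of `T ≅ Fˣ` is extended to `B`
by letting `U` act trivially. -/
def Nmod (θ : (F p)ˣ →* kˣ) : Submodule (kG p k) (kG p k) :=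
  Submodule.span (kG p k)
    {y | ∃ b : B p, y = γ p k (b : G p) - ((θ (Bdiag p b) : k)) • (1 : kG p k)}

/-- The induced module `M(θ) = kG ⊗_{kB} k_θ`, realized as `kG / N(θ)` where
`N(θ)` is the left submodule generated by the elements `b - θ(b)·1`, `b ∈ B`. -/
def Mmod (θ : (F p)ˣ →* kˣ) : Type := kG p k ⧸ Nmod p k θ

instance (θ : (F p)ˣ →* kˣ) : AddCommGroup (Mmod p k θ) :=
  inferInstanceAs (AddCommGroup (kG p k ⧸ Nmod p k θ))
instance (θ : (F p)ˣ →* kˣ) : Module (kG p k) (Mmod p k θ) :=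
  inferInstanceAs (Module (kG p k) (kG p k ⧸ Nmod p k θ))
instance (θ : (F p)ˣ →* kˣ) : Module k (Mmod p k θ) :=
  inferInstanceAs (Module k (kG p k ⧸ Nmod p k θ))
instance (θ : (F p)ˣ →* kˣ) : IsScalarTower k (kG p k) (Mmod p k θ) :=
  inferInstanceAs (IsScalarTower k (kG p k) (kG p k ⧸ Nmod p k θ))

/-- The canonical generator `1_θ ∈ M(θ)`. -/
def oneθ (θ : (F p)ˣ →* kˣ) : Mmod p k θ :=
  Submodule.Quotient.mk (1 : kG p k)

/-- `η = (1 - s)·1_tr ∈ M(tr)`. -/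
def eta : Mmod p k 1 :=
  Submodule.Quotient.mk ((1 : kG p k) - γ p k (sG p))

/-- The Steinberg module `St = kG·η ⊆ M(tr)`. -/
def St : Submodule (kG p k) (Mmod p k 1) :=
  Submodule.span (kG p k) {eta p k}

/-- `ε(x)·η` as an element of `St`. -/
def E (x : F p) : ↥(St p k) :=
  ⟨γ p k (eps p x) • eta p k,
    Submodule.smul_mem _ _ (Submodule.mem_span_singleton_self _)⟩

/-- The action of a group element on `St`, as a `k`-linear map. -/
def gSt (g : G p) : ↥(St p k) →ₗ[k] ↥(St p k) where
  toFun v := ⟨γ p k g • (v : Mmod p k 1), Submodule.smul_mem _ _ v.2⟩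
  map_add' := by intro a b; apply Subtype.ext; simp [smul_add]
  map_smul' := by
    intro c v; apply Subtype.ext
    simp [smul_comm (γ p k g) c]

/-- `St ⊗_k St`. -/
abbrev StT : Type := ↥(St p k) ⊗[k] ↥(St p k)

/-- The diagonal action of a group element on `St ⊗_k St`. -/
def gTT (g : G p) : StT p k →ₗ[k] StT p k :=
  TensorProduct.map (gSt p k g) (gSt p k g)

/-- `ω_{x,y} = (ε(x)η ⊗ ε(y)η + ε(y)η ⊗ ε(x)η)/2`. -/
def ω (x y : F p) : StT p k :=
  (2 : k)⁻¹ • (E p k x ⊗ₜ[k] E p k y + E p k y ⊗ₜ[k] E p k x)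

/-- `ρ_{x,y} = (ε(x)η ⊗ ε(y)η − ε(y)η ⊗ ε(x)η)/2`. -/
def ρ (x y : F p) : StT p k :=
  (2 : k)⁻¹ • (E p k x ⊗ₜ[k] E p k y - E p k y ⊗ₜ[k] E p k x)

/-- `V₊`, the span of the `ω_{x,y}`. -/
def Vplus : Submodule k (StT p k) :=
  Submodule.span k {v | ∃ x y : F p, v = ω p k x y}

/-- `V₋`, the span of the `ρ_{x,y}` for `x ≠ y`. -/
def Vminus : Submodule k (StT p k) :=
  Submodule.span k {v | ∃ x y : F p, x ≠ y ∧ v = ρ p k x y}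


/-- The subspace `V₊⁰` spanned by `{ω_{x,x} − ω_{0,0} : x ≠ 0}` and
`{2ω_{x,y} − ω_{0,0} : x ≠ y}`. -/
def Vzero : Submodule k (StT p k) :=
  Submodule.span k
    ({v | ∃ x : F p, x ≠ 0 ∧ v = ω p k x x - ω p k 0 0} ∪
      {v | ∃ x y : F p, x ≠ y ∧ v = (2 : k) • ω p k x y - ω p k 0 0})

section Bruhat

variable {K : Type*} [Field K]

/-- The upper unitriangular matrix with off-diagonal entry `x`. -/
def uni (x : K) : Matrix.SpecialLinearGroup (Fin 2) K :=
  ⟨!![1, x; 0, 1], by simp [Matrix.det_fin_two_of]⟩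

/-- The diagonal matrix `diag(t, t⁻¹)`. -/
def tor (t : Kˣ) : Matrix.SpecialLinearGroup (Fin 2) K :=
  ⟨!![(t : K), 0; 0, ((t⁻¹ : Kˣ) : K)], by simp [Matrix.det_fin_two_of]⟩

/-- The Weyl element. -/
def wey : Matrix.SpecialLinearGroup (Fin 2) K :=
  ⟨!![0, 1; -1, 0], by simp [Matrix.det_fin_two_of]⟩

lemma coe_uni (x : K) : (uni x : Matrix (Fin 2) (Fin 2) K) = !![1, x; 0, 1] := rfl

lemma coe_tor (t : Kˣ) : (tor t : Matrix (Fin 2) (Fin 2) K) = !![(t : K), 0; 0, (t : K)⁻¹] := by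
  simp [tor]

lemma coe_wey : ((wey : Matrix.SpecialLinearGroup (Fin 2) K) : Matrix (Fin 2) (Fin 2) K) =
    !![0, 1; -1, 0] := rfl

lemma coe_uni_mul_tor (x : K) (t : Kˣ) :
    ((uni x * tor t : Matrix.SpecialLinearGroup (Fin 2) K) : Matrix (Fin 2) (Fin 2) K) =
      !![(t : K), x * (t : K)⁻¹; 0, (t : K)⁻¹] := by
  simp [coe_uni, coe_tor, Matrix.SpecialLinearGroup.coe_mul]

lemma coe_uni_wey_uni_tor (x z : K) (t : Kˣ) :
    ((uni x * wey * uni z * tor t : Matrix.SpecialLinearGroup (Fin 2) K) :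
      Matrix (Fin 2) (Fin 2) K) =
      !![-x * t, (1 - x * z) * (t : K)⁻¹; -t, -z * (t : K)⁻¹] := by
  simp only [coe_uni, coe_tor, coe_wey, Matrix.SpecialLinearGroup.coe_mul]
  ext i j
  fin_cases i <;> fin_cases j <;> simp
  ring

/-- The Borel cell of the Bruhat decomposition. -/
def borelEquiv : K × Kˣ ≃
    {g : Matrix.SpecialLinearGroup (Fin 2) K // (g : Matrix (Fin 2) (Fin 2) K) 1 0 = 0} :=
  Equiv.ofBijective (fun q => ⟨uni q.1 * tor q.2, by rw [coe_uni_mul_tor]; simp⟩) <| by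
    constructor
    · rintro ⟨x, t⟩ ⟨x', t'⟩ hq
      have hm := congrArg (fun g => ((g.1 : Matrix.SpecialLinearGroup (Fin 2) K) :
        Matrix (Fin 2) (Fin 2) K)) hq
      simp only [coe_uni_mul_tor] at hm
      have h00 := congrFun (congrFun hm 0) 0
      have h01 := congrFun (congrFun hm 0) 1
      simp only [Matrix.of_apply, Matrix.cons_val] at h00 h01
      obtain rfl : t = t' := Units.ext h00
      simpa using h01
    · rintro ⟨g, hg⟩
      have hdet := g.det_coe
      rw [Matrix.det_fin_two, hg, mul_zero, sub_zero] at hdet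
      have h0 : g 0 0 ≠ 0 := left_ne_zero_of_mul_eq_one hdet
      refine ⟨(g 0 1 * g 0 0, Units.mk0 _ h0), ?_⟩
      ext i j
      simp only [coe_uni_mul_tor]
      fin_cases i <;> fin_cases j <;> simp [h0, hg]
      exact inv_eq_of_mul_eq_one_right hdet

/-- The big cell of the Bruhat decomposition. -/
def bigCellEquiv : (K × K) × Kˣ ≃
    {g : Matrix.SpecialLinearGroup (Fin 2) K // ¬ (g : Matrix (Fin 2) (Fin 2) K) 1 0 = 0} :=
  Equiv.ofBijective (fun q => ⟨uni q.1.1 * wey * uni q.1.2 * tor q.2,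
      by rw [coe_uni_wey_uni_tor]; simp⟩) <| by
    constructor
    · rintro ⟨⟨x, z⟩, t⟩ ⟨⟨x', z'⟩, t'⟩ hq
      have hm := congrArg (fun g => ((g.1 : Matrix.SpecialLinearGroup (Fin 2) K) :
        Matrix (Fin 2) (Fin 2) K)) hq
      simp only [coe_uni_wey_uni_tor] at hm
      have h10 := congrFun (congrFun hm 1) 0
      have h00 := congrFun (congrFun hm 0) 0
      have h11 := congrFun (congrFun hm 1) 1
      simp only [Matrix.of_apply, Matrix.cons_val] at h00 h10 h11
      obtain rfl : t = t' := Units.ext (neg_injective h10)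
      simpa using And.intro h00 h11
    · rintro ⟨g, hg⟩
      have hdet := g.det_coe
      rw [Matrix.det_fin_two] at hdet
      refine ⟨((g 0 0 / g 1 0, g 1 0 * g 1 1), Units.mk0 (-g 1 0) (neg_ne_zero.2 hg)), ?_⟩
      ext i j
      simp only [coe_uni_wey_uni_tor]
      fin_cases i <;> fin_cases j <;> simp <;> field_simp
      linear_combination hdet

lemma coe_uni_wey (x : K) :
    ((uni x * wey : Matrix.SpecialLinearGroup (Fin 2) K) : Matrix (Fin 2) (Fin 2) K) =
      !![-x, 1; -1, 0] := by
  simp [coe_uni, coe_wey]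

lemma coe_wey_uni_wey (z : K) :
    ((wey * uni z * wey : Matrix.SpecialLinearGroup (Fin 2) K) : Matrix (Fin 2) (Fin 2) K) =
      !![-1, 0; z, -1] := by
  simp [coe_uni, coe_wey]

lemma inv_mul_apply_one_zero (g g' : Matrix.SpecialLinearGroup (Fin 2) K)
    (hg : g 0 0 * g' 1 0 = g 1 0 * g' 0 0) :
    ((g'⁻¹ * g : Matrix.SpecialLinearGroup (Fin 2) K) : Matrix (Fin 2) (Fin 2) K) 1 0 = 0 := by
  simp [Matrix.SpecialLinearGroup.coe_inv, Matrix.adjugate_fin_two, Matrix.mul_apply,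
    Fin.sum_univ_two]
  linear_combination -hg

lemma uni_mul_uni (x y : K) : uni x * uni y = uni (x + y) := by
  apply Subtype.ext
  simp [coe_uni, add_comm]

lemma tor_mul_uni (t : Kˣ) (x : K) : tor t * uni x = uni ((t : K) ^ 2 * x) * tor t := by
  apply Subtype.ext
  simp only [Matrix.SpecialLinearGroup.coe_mul, coe_uni, coe_tor]
  ext i j
  fin_cases i <;> fin_cases j <;> simp
  field_simp

lemma tor_mul_wey (t : Kˣ) : tor t * wey = wey * tor t⁻¹ := by
  apply Subtype.ext
  simp [coe_wey, coe_tor]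

lemma sum_specialLinearGroup [Fintype K] [DecidableEq K] {V : Type*} [AddCommMonoid V]
    (f : Matrix.SpecialLinearGroup (Fin 2) K → V) :
    ∑ g, f g = (∑ x, ∑ t, f (uni x * tor t)) +
      ∑ x, ∑ z, ∑ t, f (uni x * wey * uni z * tor t) := by
  rw [← Fintype.sum_subtype_add_sum_subtype
    (fun g : Matrix.SpecialLinearGroup (Fin 2) K => (g : Matrix (Fin 2) (Fin 2) K) 1 0 = 0) f,
    ← borelEquiv.sum_comp, ← bigCellEquiv.sum_comp, Fintype.sum_prod_type, Fintype.sum_prod_type,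
    Fintype.sum_prod_type]
  rfl

end Bruhat

section FiniteField

variable {K : Type*} [Field K] [Fintype K] [DecidableEq K]

lemma sum_eq_zero_add_sum_units {V : Type*} [AddCommMonoid V] (f : K → V) :
    ∑ x, f x = f 0 + ∑ x : Kˣ, f x := by
  rw [← Fintype.sum_subtype_add_sum_subtype (fun x => x = 0) f]
  congr 1
  · convert Fintype.sum_subsingleton (fun x : {x : K // x = 0} => f x) ⟨0, rfl⟩
  · exact (unitsEquivNeZero.sum_comp (fun x : {x : K // x ≠ 0} => f x)).symm

variable {p} in
lemma sum_units_sum_mul {V : Type*} [AddCommMonoid V] {K L : Subfield (F p)} [Fintype K]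
    [Fintype L] [DecidableEq K] [DecidableEq L] (hKL : K ≤ L) (u : F p → V) :
    ∑ c : Lˣ, ∑ z : K, u ((c : L) * (z : F p)) =
      Fintype.card Lˣ • u 0 + Fintype.card Kˣ • ∑ c : Lˣ, u (c : L) := by
  simp_rw [sum_eq_zero_add_sum_units (K := K), Finset.sum_add_distrib]
  rw [Finset.sum_comm]
  simp only [ZeroMemClass.coe_zero, mul_zero, Finset.sum_const, Finset.card_univ]
  congr 1
  rw [← Finset.card_univ, ← Finset.sum_const]
  refine Finset.sum_congr rfl fun z _ => ?_
  exact Equiv.sum_comp (Equiv.mulRight (Units.map (Subfield.inclusion hKL : K →* L) z))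
    (fun c : Lˣ => u (c : L))

end FiniteField

variable {p} in
lemma exists_finite_subfield (S : Set (F p)) (hS : S.Finite) :
    ∃ K : Subfield (F p), Finite K ∧ S ⊆ K := by
  have := hS.to_subtype
  let K := IntermediateField.adjoin (ZMod p) S
  have : FiniteDimensional (ZMod p) K :=
    IntermediateField.finiteDimensional_adjoin fun x _ => Algebra.IsIntegral.isIntegral x
  exact ⟨K.toSubfield, Module.finite_of_finite (ZMod p) (M := K),
    IntermediateField.subset_adjoin _ _⟩

variable {p} in
lemma exists_finite_subfield_gt (K : Subfield (F p)) [Finite K] :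
    ∃ L : Subfield (F p), Finite L ∧ K < L := by
  have : Infinite (F p) := IsAlgClosed.instInfinite
  obtain ⟨x, hx⟩ := (Set.toFinite (K : Set (F p))).exists_notMem
  obtain ⟨L, hL, hKL⟩ := exists_finite_subfield (insert x (K : Set (F p))) (Set.toFinite _)
  rw [Set.insert_subset_iff] at hKL
  exact ⟨L, hL, lt_of_le_of_ne hKL.2 fun he => hx (he ▸ hKL.1)⟩

section Relations

variable {p}

lemma eps_mul_eps (x y : F p) : eps p x * eps p y = eps p (x + y) :=
  uni_mul_uni x y

lemma h_mul_eps (t : (F p)ˣ) (x : F p) : h p t * eps p x = eps p ((t : F p) ^ 2 * x) * h p t :=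
  tor_mul_uni t x

lemma h_mul_sG (t : (F p)ˣ) : h p t * sG p = sG p * h p t⁻¹ :=
  tor_mul_wey t

lemma eps_zero : eps p 0 = 1 := by
  ext i j
  fin_cases i <;> fin_cases j <;> rfl

lemma exists_bruhat (g : G p) :
    (∃ x t, g = eps p x * h p t) ∨ ∃ x z t, g = eps p x * sG p * eps p z * h p t := by
  by_cases hg : (g : Matrix (Fin 2) (Fin 2) (F p)) 1 0 = 0
  · obtain ⟨q, hq⟩ := borelEquiv.surjective ⟨g, hg⟩
    exact Or.inl ⟨q.1, q.2, (congrArg Subtype.val hq).symm⟩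
  · obtain ⟨q, hq⟩ := bigCellEquiv.surjective ⟨g, hg⟩
    exact Or.inr ⟨q.1.1, q.1.2, q.2, (congrArg Subtype.val hq).symm⟩

/-- The inclusion `SL₂(K) → G` for a subfield `K` of `F`. -/
def incl (K : Subfield (F p)) : Matrix.SpecialLinearGroup (Fin 2) K →* G p :=
  Matrix.SpecialLinearGroup.map K.subtype

variable (K : Subfield (F p))

lemma incl_apply (g : Matrix.SpecialLinearGroup (Fin 2) K) (i j : Fin 2) :
    (incl K g : Matrix (Fin 2) (Fin 2) (F p)) i j = (g i j : F p) :=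
  rfl

lemma incl_uni (x : K) : incl K (uni x) = eps p x := by
  ext i j
  rw [incl_apply]
  fin_cases i <;> fin_cases j <;> rfl

lemma incl_wey : incl K wey = sG p := by
  ext i j
  rw [incl_apply]
  fin_cases i <;> fin_cases j <;> simp [sG, wey]

lemma incl_tor (t : Kˣ) : incl K (tor t) = h p (Units.map K.subtype t) := by
  ext i j
  rw [incl_apply]
  fin_cases i <;> fin_cases j <;> simp [h, tor]

lemma mem_range_incl (g : G p)
    (hg : ∀ i j, (g : Matrix (Fin 2) (Fin 2) (F p)) i j ∈ K) : g ∈ (incl K).range := by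
  refine ⟨⟨Matrix.of fun i j => ⟨g i j, hg i j⟩, ?_⟩, ?_⟩
  · apply Subtype.ext
    have hdet := g.det_coe
    rw [Matrix.det_fin_two] at hdet ⊢
    simpa using hdet
  · ext i j
    rfl

end Relations

section InducedVector

variable {p}
variable {R V : Type*} [Field R] [AddCommGroup V] [Module R V] (ρ : Representation R (G p) V)

/-- The sum of the actions of the unipotent elements with entries in `K`. -/
def uniSum (K : Subfield (F p)) [Fintype K] : V →ₗ[R] V := ∑ x : K, ρ (eps p x)

/-- The sum of the translates of `w` by representatives of the cosets of the torus
in `SL₂(K)`. -/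
def orbitSum (K : Subfield (F p)) [Fintype K] (w : V) : V :=
  uniSum ρ K (w + ∑ z : K, ρ (sG p) (ρ (eps p z) w))

variable {ρ} {w : V}

lemma uniSum_apply (K : Subfield (F p)) [Fintype K] (v : V) :
    uniSum ρ K v = ∑ x : K, ρ (eps p x) v := by
  simp [uniSum]

lemma h_smul_eps (t : (F p)ˣ) (x : F p) (v : V) :
    ρ (h p t) (ρ (eps p x) v) = ρ (eps p ((t : F p) ^ 2 * x)) (ρ (h p t) v) := by
  rw [← Module.End.mul_apply, ← map_mul, h_mul_eps, map_mul, Module.End.mul_apply]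

lemma h_smul_s (t : (F p)ˣ) (v : V) :
    ρ (h p t) (ρ (sG p) v) = ρ (sG p) (ρ (h p t⁻¹) v) := by
  rw [← Module.End.mul_apply, ← map_mul, h_mul_sG, map_mul, Module.End.mul_apply]

lemma eps_zero_smul (v : V) : ρ (eps p 0) v = v := by
  rw [eps_zero, map_one, Module.End.one_apply]

lemma uniSum_eps {L : Subfield (F p)} [Fintype L] (y : L) (v : V) :
    uniSum ρ L (ρ (eps p y) v) = uniSum ρ L v := by
  simp_rw [uniSum_apply, ← Module.End.mul_apply, ← map_mul, eps_mul_eps]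
  exact Equiv.sum_comp (Equiv.addRight y) (fun x : L => ρ (eps p x) v)

lemma sum_incl_eq (hT : ∀ t, ρ (h p t) w = w) (K : Subfield (F p)) [Fintype K] [DecidableEq K] :
    ∑ g, ρ (incl K g) w = Fintype.card Kˣ • orbitSum ρ K w := by
  rw [sum_specialLinearGroup]
  simp [incl_uni, incl_wey, incl_tor, hT, orbitSum, uniSum_apply, Finset.smul_sum,
    Finset.sum_add_distrib]

lemma exists_units_sq_eq (c : (F p)ˣ) : ∃ t : (F p)ˣ, t ^ 2 = c := by
  obtain ⟨t, ht⟩ := IsAlgClosed.exists_pow_nat_eq (c : F p) (n := 2) (by norm_num)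
  have h0 : t ≠ 0 := by
    rintro rfl
    exact c.ne_zero (by simpa using ht.symm)
  exact ⟨Units.mk0 t h0, Units.ext (by simpa using ht)⟩

variable [CharZero R] {W : Submodule R V}

lemma nsmul_mem_iff_of_ne_zero {n : ℕ} (hn : n ≠ 0) {v : V} : n • v ∈ W ↔ v ∈ W := by
  rw [← Nat.cast_smul_eq_nsmul R, W.smul_mem_iff (Nat.cast_ne_zero.2 hn)]

lemma card_units_lt {K L : Subfield (F p)} [Fintype K] [Fintype L] [DecidableEq K] [DecidableEq L]
    (hKL : K < L) : Fintype.card Kˣ < Fintype.card Lˣ := by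
  have hlt : Fintype.card K < Fintype.card L :=
    Set.card_lt_card (SetLike.coe_ssubset_coe.2 hKL)
  rw [Fintype.card_units, Fintype.card_units]
  have : 0 < Fintype.card K := Fintype.card_pos
  omega

variable (hW : ∀ g v, v ∈ W → ρ g v ∈ W)
include hW

omit [CharZero R] in
lemma uniSum_mem (L : Subfield (F p)) [Fintype L] {v : V} (hv : v ∈ W) : uniSum ρ L v ∈ W := by
  rw [uniSum_apply]
  exact W.sum_mem fun x _ => hW _ _ hv

variable (hT : ∀ t, ρ (h p t) w = w)
include hT

lemma uniSum_mem_of_orbitSum_mem (hs : ρ (sG p) w = w) {K L : Subfield (F p)} [Fintype K]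
    [Fintype L] (hKL : K < L) (hK : orbitSum ρ K w ∈ W) (hL : orbitSum ρ L w ∈ W) :
    uniSum ρ L w ∈ W := by
  classical
  have key (c : Lˣ) :
      uniSum ρ L (w + ∑ z : K, ρ (sG p) (ρ (eps p ((c : L) * (z : F p))) w)) ∈ W := by
    obtain ⟨t, ht⟩ := exists_units_sq_eq (Units.map (L.subtype : L →* F p) c⁻¹)
    have ht' : (t : F p) ^ 2 = ((c⁻¹ : Lˣ) : L) := congrArg Units.val ht
    have ht'' : ((t⁻¹ : (F p)ˣ) : F p) ^ 2 = (c : L) := by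
      have := congrArg Units.val (congrArg (·⁻¹) ht)
      simpa using this
    have hm := hW (h p t) _ hK
    rw [orbitSum, uniSum_apply, map_sum] at hm
    simp_rw [h_smul_eps, map_add, map_sum, h_smul_s, h_smul_eps, hT, ht', ht''] at hm
    replace hm := uniSum_mem hW L hm
    rw [← nsmul_mem_iff_of_ne_zero (n := Fintype.card K) Fintype.card_ne_zero]
    convert hm using 1
    rw [map_sum, ← Finset.card_univ, ← Finset.sum_const]
    refine Finset.sum_congr rfl fun x _ => ?_
    rw [← map_sum (ρ (eps p (((c⁻¹ : Lˣ) : L) * (x : F p)))), ← map_add]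
    exact (uniSum_eps (((c⁻¹ : Lˣ) : L) * Subfield.inclusion hKL.le x) _).symm
  have hsum := W.sum_mem (t := Finset.univ) fun c (_ : c ∈ Finset.univ) => key c
  rw [← map_sum, Finset.sum_add_distrib,
    sum_units_sum_mul hKL.le (fun z => ρ (sG p) (ρ (eps p z) w)), eps_zero_smul, hs] at hsum
  rw [orbitSum, sum_eq_zero_add_sum_units] at hL
  simp only [ZeroMemClass.coe_zero, eps_zero_smul, hs] at hL
  obtain ⟨d, hd⟩ := Nat.exists_eq_add_of_lt (card_units_lt hKL)
  rw [← nsmul_mem_iff_of_ne_zero (n := 2 * (d + 1)) (by omega)]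
  convert W.sub_mem hsum (W.nsmul_mem hL (Fintype.card Kˣ)) using 1
  simp only [Finset.sum_const, Finset.card_univ, hd, map_add, map_nsmul]
  module

lemma mem_of_uniSum_mem {K L : Subfield (F p)} [Fintype K] [Fintype L] (hKL : K < L)
    (hK : uniSum ρ K w ∈ W) (hL : uniSum ρ L w ∈ W) : w ∈ W := by
  classical
  have key (c : Lˣ) : ∑ z : K, ρ (eps p ((c : L) * (z : F p))) w ∈ W := by
    obtain ⟨t, ht⟩ := exists_units_sq_eq (Units.map (L.subtype : L →* F p) c)
    have ht' : (t : F p) ^ 2 = (c : L) := congrArg Units.val ht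
    have hm := hW (h p t) _ hK
    rw [uniSum_apply, map_sum] at hm
    simpa only [h_smul_eps, hT, ht'] using hm
  have hsum : ∑ c : Lˣ, ∑ z : K, ρ (eps p ((c : L) * (z : F p))) w ∈ W :=
    W.sum_mem fun c _ => key c
  rw [sum_units_sum_mul hKL.le (fun z => ρ (eps p z) w), eps_zero_smul] at hsum
  rw [uniSum_apply, sum_eq_zero_add_sum_units] at hL
  simp only [ZeroMemClass.coe_zero, eps_zero_smul] at hL
  obtain ⟨d, hd⟩ := Nat.exists_eq_add_of_lt (card_units_lt hKL)
  rw [← nsmul_mem_iff_of_ne_zero (n := d + 1) (by omega)]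
  convert W.sub_mem hsum (W.nsmul_mem hL (Fintype.card Kˣ)) using 1
  rw [hd]
  module

omit hW hT [CharZero R] in
lemma sum_smul_sub_of_sum_eq_zero {ι : Type*} (c : ι →₀ R) (hc : c.sum (fun _ a => a) = 0)
    (u : ι → V) (w : V) : c.sum (fun i a => a • (u i - w)) = c.sum (fun i a => a • u i) := by
  rw [Finsupp.sum] at hc
  simp only [Finsupp.sum, smul_sub, Finset.sum_sub_distrib, ← Finset.sum_smul, hc, zero_smul,
    sub_zero]

/-- If `w` is fixed by the normalizer of the torus, then any linear combination of translates of `w`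
with nonzero coefficient sum generates `w`. -/
theorem mem_of_sum_mem (hs : ρ (sG p) w = w) (c : G p →₀ R) (hc : c.sum (fun _ a => a) ≠ 0)
    (hmem : c.sum (fun g a => a • ρ g w) ∈ W) : w ∈ W := by
  classical
  obtain ⟨K, hK, hcK⟩ := exists_finite_subfield
    (⋃ g ∈ c.support, Set.range fun ij : Fin 2 × Fin 2 =>
      (g : Matrix (Fin 2) (Fin 2) (F p)) ij.1 ij.2)
    (Set.Finite.biUnion c.support.finite_toSet fun g _ => Set.finite_range _)
  have horb (L : Subfield (F p)) [Fintype L] (hKL : K ≤ L) : orbitSum ρ L w ∈ W := by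
    have hsum : ∑ g, ρ (incl L g) (c.sum (fun g a => a • ρ g w)) ∈ W :=
      W.sum_mem fun g _ => hW _ _ hmem
    have heq : ∑ g, ρ (incl L g) (c.sum (fun g a => a • ρ g w)) =
        c.sum (fun _ a => a) • ∑ g, ρ (incl L g) w := by
      simp only [Finsupp.sum, map_sum, map_smul]
      rw [Finset.sum_comm, Finset.sum_smul]
      refine Finset.sum_congr rfl fun g hg => ?_
      rw [← Finset.smul_sum]
      congr 1
      obtain ⟨g', rfl⟩ := mem_range_incl L g fun i j => hKL <| hcK <|
        Set.mem_biUnion (Finset.mem_coe.2 hg) ⟨(i, j), rfl⟩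
      simp_rw [← Module.End.mul_apply, ← map_mul]
      exact Equiv.sum_comp (Equiv.mulRight g') (fun g => ρ (incl L g) w)
    rw [heq, W.smul_mem_iff hc, sum_incl_eq hT, nsmul_mem_iff_of_ne_zero Fintype.card_ne_zero]
      at hsum
    exact hsum
  obtain ⟨L, hL, hKL⟩ := exists_finite_subfield_gt K
  obtain ⟨M, hM, hLM⟩ := exists_finite_subfield_gt L
  have := Fintype.ofFinite K
  have := Fintype.ofFinite L
  have := Fintype.ofFinite M
  have hKo := horb K le_rfl
  exact mem_of_uniSum_mem hW hT hLM
    (uniSum_mem_of_orbitSum_mem hW hT hs hKL hKo (horb L hKL.le))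
    (uniSum_mem_of_orbitSum_mem hW hT hs (hKL.trans hLM) hKo (horb M (hKL.trans hLM).le))

end InducedVector

section Steinberg

variable {p} {k : Type} [Field k]

instance : AddSubgroupClass (Submodule k (StT p k)) (StT p k) :=
  @Submodule.addSubgroupClass k (StT p k) _ _ _

lemma γ_mul (g g' : G p) : γ p k (g * g') = γ p k g * γ p k g' :=
  map_mul _ _ _

lemma γ_one : γ p k 1 = 1 :=
  map_one _

/-- The diagonal representation of `G` on `St ⊗ St`. -/
def steinbergSq : Representation k (G p) (StT p k) where
  toFun := gTT p k
  map_one' := by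
    have h1 : gSt p k 1 = LinearMap.id := by
      ext v
      simp [gSt, γ_one]
    rw [gTT, h1, TensorProduct.map_id]
    rfl
  map_mul' g g' := by
    have h1 : gSt p k (g * g') = gSt p k g ∘ₗ gSt p k g' := by
      ext v
      simp [gSt, γ_mul, mul_smul]
    rw [gTT, h1, TensorProduct.map_comp]
    rfl

lemma gTT_mul (g g' : G p) (v : StT p k) : gTT p k (g * g') v = gTT p k g (gTT p k g' v) :=
  LinearMap.congr_fun (map_mul steinbergSq g g') v

variable (k) in
/-- The image of `g` in `M(tr)`. -/
def mk (g : G p) : Mmod p k 1 := Submodule.Quotient.mk (γ p k g)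

lemma mk_mul_of_mem_borel (g : G p) {b : G p} (hb : b ∈ B p) : mk k (g * b) = mk k g := by
  refine (Submodule.Quotient.eq _).2 ?_
  have := (Nmod p k 1).smul_mem (γ p k g) (Submodule.subset_span ⟨⟨b, hb⟩, rfl⟩)
  simpa [γ_mul, mul_sub] using this

lemma mk_eq_mk {g g' : G p} (hg : g 0 0 * g' 1 0 = g 1 0 * g' 0 0) : mk k g = mk k g' := by
  rw [← mk_mul_of_mem_borel g' (inv_mul_apply_one_zero g g' hg), mul_inv_cancel_left]

lemma γ_smul_eta (g : G p) : γ p k g • eta p k = mk k g - mk k (g * sG p) := by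
  change Submodule.Quotient.mk (γ p k g * (1 - γ p k (sG p))) = _
  rw [mul_sub, mul_one, ← γ_mul]
  rfl

lemma coe_E (x : F p) : (E p k x : Mmod p k 1) = mk k (eps p x) - mk k (eps p x * sG p) :=
  γ_smul_eta _

lemma coe_gSt_E (g : G p) (x : F p) :
    (gSt p k g (E p k x) : Mmod p k 1) = mk k (g * eps p x) - mk k (g * eps p x * sG p) := by
  rw [← γ_smul_eta, γ_mul, mul_smul]
  rfl

lemma mk_eps (x : F p) : mk k (eps p x) = mk k 1 := by
  rw [← one_mul (eps p x)]
  exact mk_mul_of_mem_borel 1 (rfl : eps p x ∈ B p)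

lemma gSt_eps_E (x y : F p) : gSt p k (eps p x) (E p k y) = E p k (x + y) := by
  apply Subtype.ext
  rw [coe_gSt_E, eps_mul_eps, coe_E]

lemma gSt_h_E_zero (t : (F p)ˣ) : gSt p k (h p t) (E p k 0) = E p k 0 := by
  have hB (t) : h p t ∈ B p := rfl
  apply Subtype.ext
  rw [coe_gSt_E, coe_E, h_mul_eps, mul_zero, mk_mul_of_mem_borel _ (hB t), mul_assoc, h_mul_sG,
    ← mul_assoc, mk_mul_of_mem_borel _ (hB _)]

lemma gSt_sG_E_zero : gSt p k (sG p) (E p k 0) = -E p k 0 := by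
  apply Subtype.ext
  rw [Submodule.coe_neg, coe_gSt_E, coe_E, eps_zero, mul_one, one_mul, neg_sub]
  have hB : sG p * eps p 0 * sG p ∈ B p :=
    congrFun (congrFun (coe_wey_uni_wey (0 : F p)) 1) 0
  rw [eps_zero, mul_one] at hB
  rw [← one_mul (sG p * sG p), mk_mul_of_mem_borel 1 hB]

lemma gSt_sG_E {z : F p} (hz : z ≠ 0) :
    gSt p k (sG p) (E p k z) = E p k (-z⁻¹) - E p k 0 := by
  apply Subtype.ext
  have h1 : mk k (sG p * eps p z * sG p) = mk k (eps p (-z⁻¹) * sG p) := by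
    apply mk_eq_mk
    have h1 := coe_wey_uni_wey z
    have h2 := coe_uni_wey (-z⁻¹)
    change (wey * uni z * wey : Matrix.SpecialLinearGroup (Fin 2) (F p)) 0 0 *
      (uni (-z⁻¹) * wey : Matrix.SpecialLinearGroup (Fin 2) (F p)) 1 0 =
      (wey * uni z * wey : Matrix.SpecialLinearGroup (Fin 2) (F p)) 1 0 *
      (uni (-z⁻¹) * wey : Matrix.SpecialLinearGroup (Fin 2) (F p)) 0 0
    rw [h1, h2]
    simp [hz]
  have h2 : eps p z ∈ B p := rfl
  rw [AddSubgroupClass.coe_sub, coe_gSt_E, coe_E, coe_E, h1, mk_mul_of_mem_borel _ h2, mk_eps, mk_eps,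
    eps_zero, one_mul]
  abel

variable [CharZero k]

lemma ω_self (x : F p) : ω p k x x = E p k x ⊗ₜ E p k x := by
  rw [ω, ← two_smul k, smul_smul, inv_mul_cancel₀ two_ne_zero, one_smul]

lemma sub_tmul_sub (x y : F p) :
    (E p k x - E p k y) ⊗ₜ[k] (E p k x - E p k y) =
      ω p k x x + ω p k y y - (2 : k) • ω p k x y := by
  rw [ω_self, ω_self, ω, smul_smul, mul_inv_cancel₀ two_ne_zero, one_smul, TensorProduct.sub_tmul,
    TensorProduct.tmul_sub, TensorProduct.tmul_sub]
  abel

lemma gTT_h_ω_zero (t : (F p)ˣ) : gTT p k (h p t) (ω p k 0 0) = ω p k 0 0 := by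
  rw [ω_self, gTT, TensorProduct.map_tmul, gSt_h_E_zero]

lemma gTT_sG_ω_zero : gTT p k (sG p) (ω p k 0 0) = ω p k 0 0 := by
  rw [ω_self, gTT, TensorProduct.map_tmul, gSt_sG_E_zero, TensorProduct.neg_tmul,
    TensorProduct.tmul_neg]
  exact neg_neg (E p k 0 ⊗ₜ[k] E p k 0)

omit [CharZero k] in
lemma gTT_eps_ω (x y z : F p) : gTT p k (eps p x) (ω p k y z) = ω p k (x + y) (x + z) := by
  simp [ω, gTT, gSt_eps_E]

lemma gTT_eps_sG_eps_ω (x : F p) {z : F p} (hz : z ≠ 0) :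
    gTT p k (eps p x * sG p * eps p z) (ω p k 0 0) =
      ω p k (x - z⁻¹) (x - z⁻¹) + ω p k x x - (2 : k) • ω p k (x - z⁻¹) x := by
  rw [gTT_mul, gTT_eps_ω, add_zero, gTT_mul, ω_self, gTT, gTT, TensorProduct.map_tmul,
    gSt_sG_E hz, TensorProduct.map_tmul, map_sub, gSt_eps_E, gSt_eps_E, add_zero,
    ← sub_eq_add_neg, sub_tmul_sub]

lemma gTT_ω_zero_cases (g : G p) :
    (∃ x, gTT p k g (ω p k 0 0) = ω p k x x) ∨
      ∃ x y, x ≠ y ∧ gTT p k g (ω p k 0 0) = ω p k x x + ω p k y y - (2 : k) • ω p k x y := by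
  obtain ⟨x, t, rfl⟩ | ⟨x, z, t, rfl⟩ := exists_bruhat g
  · left
    exact ⟨x, by rw [gTT_mul, gTT_h_ω_zero, gTT_eps_ω, add_zero]⟩
  · rw [gTT_mul, gTT_h_ω_zero]
    obtain rfl | hz := eq_or_ne z 0
    · left
      exact ⟨x, by rw [eps_zero, mul_one, gTT_mul, gTT_sG_ω_zero, gTT_eps_ω, add_zero]⟩
    · right
      exact ⟨x - z⁻¹, x, by simpa using hz, gTT_eps_sG_eps_ω x hz⟩

lemma gTT_ω_zero_mem (g : G p) : gTT p k g (ω p k 0 0) ∈ Vplus p k := by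
  have hω (x y) : ω p k x y ∈ Vplus p k := Submodule.subset_span ⟨x, y, rfl⟩
  obtain ⟨x, hx⟩ | ⟨x, y, -, hxy⟩ := gTT_ω_zero_cases (k := k) g
  · exact hx ▸ hω x x
  · exact hxy ▸ sub_mem (add_mem (hω x x) (hω y y)) (Submodule.smul_mem _ _ (hω x y))

lemma gTT_ω_zero_sub_mem (g : G p) :
    gTT p k g (ω p k 0 0) - ω p k 0 0 ∈ Vzero p k := by
  have hd (x) : ω p k x x - ω p k 0 0 ∈ Vzero p k := by
    obtain rfl | hx := eq_or_ne x 0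
    · simp
    · exact Submodule.subset_span (Or.inl ⟨x, hx, rfl⟩)
  obtain ⟨x, hx⟩ | ⟨x, y, hne, hxy⟩ := gTT_ω_zero_cases (k := k) g
  · exact hx ▸ hd x
  · have ho : (2 : k) • ω p k x y - ω p k 0 0 ∈ Vzero p k :=
      Submodule.subset_span (Or.inr ⟨x, y, hne, rfl⟩)
    rw [hxy]
    convert sub_mem (add_mem (hd x) (hd y)) ho using 1
    abel

lemma Vplus_eq_span :
    Vplus p k = Submodule.span k (Set.range fun g : G p => gTT p k g (ω p k 0 0)) := by
  apply le_antisymm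
  · have horb (g : G p) : gTT p k g (ω p k 0 0) ∈
        Submodule.span k (Set.range fun g : G p => gTT p k g (ω p k 0 0)) :=
      Submodule.subset_span ⟨g, rfl⟩
    have hd (x : F p) : ω p k x x ∈
        Submodule.span k (Set.range fun g : G p => gTT p k g (ω p k 0 0)) := by
      simpa [gTT_eps_ω] using horb (eps p x)
    refine Submodule.span_le.2 ?_
    rintro _ ⟨x, y, rfl⟩
    obtain rfl | hne := eq_or_ne x y
    · exact hd x
    · have hm := horb (eps p y * sG p * eps p (y - x)⁻¹)
      rw [gTT_eps_sG_eps_ω _ (inv_ne_zero (sub_ne_zero.2 hne.symm)), inv_inv, sub_sub_cancel] at hm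
      have := sub_mem (add_mem (hd x) (hd y)) hm
      rw [sub_sub_cancel] at this
      exact (Submodule.smul_mem_iff _ two_ne_zero).1 this
  · refine Submodule.span_le.2 ?_
    rintro _ ⟨g, rfl⟩
    exact gTT_ω_zero_mem g

lemma gTT_mem_Vplus (g : G p) {v : StT p k} (hv : v ∈ Vplus p k) : gTT p k g v ∈ Vplus p k := by
  have : Vplus p k ≤ (Vplus p k).comap (gTT p k g) := by
    conv_lhs => rw [Vplus_eq_span]
    refine Submodule.span_le.2 ?_
    rintro _ ⟨g', rfl⟩
    simpa [gTT_mul] using gTT_ω_zero_mem (k := k) (g * g')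
  exact this hv

/-- A stable subspace containing an element of `V₊` outside `V₊⁰` contains `V₊`. -/
lemma Vplus_le_of_mem {W : Submodule k (StT p k)} (hW : ∀ g v, v ∈ W → gTT p k g v ∈ W)
    {ξ : StT p k} (hξW : ξ ∈ W) (hξ : ξ ∈ Vplus p k) (hξ0 : ξ ∉ Vzero p k) : Vplus p k ≤ W := by
  rw [Vplus_eq_span] at hξ
  obtain ⟨c, hcξ⟩ := Finsupp.mem_span_range_iff_exists_finsupp.1 hξ
  have hc : c.sum (fun _ a => a) ≠ 0 := by
    intro hc
    apply hξ0
    rw [← hcξ, ← sum_smul_sub_of_sum_eq_zero (V := StT p k) c hc _ (ω p k 0 0)]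
    exact Submodule.sum_mem _ fun g _ => Submodule.smul_mem _ _ (gTT_ω_zero_sub_mem g)
  have hmem : ω p k 0 0 ∈ W :=
    mem_of_sum_mem (V := StT p k) (ρ := steinbergSq) (W := W) (w := ω p k 0 0) hW
      gTT_h_ω_zero gTT_sG_ω_zero c hc (hcξ ▸ hξW)
  rw [Vplus_eq_span, Submodule.span_le]
  rintro _ ⟨g, rfl⟩
  exact hW g _ hmem

end Steinberg

/-- every `ξ ∈ V₊ \ V₊⁰` generates `V₊` as a `kG`-module;
consequently `V₊⁰` is the unique maximal proper `kG`-submodule of `V₊`. -/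
theorem stmt11 (hp2 : p ≠ 2) :
    (∀ ξ : StT p k, ξ ∈ Vplus p k → ξ ∉ Vzero p k →
      Submodule.span k {v : StT p k | ∃ g : G p, v = gTT p k g ξ} = Vplus p k) ∧
    (∀ W : Submodule k (StT p k),
      (∀ (g : G p) (v : StT p k), v ∈ W → gTT p k g v ∈ W) →
      W ≤ Vplus p k → W ≠ Vplus p k → W ≤ Vzero p k) := by
  refine ⟨fun ξ hξ hξ0 => le_antisymm ?_ ?_, fun W hW hWle hWne v hv => ?_⟩
  · rw [Submodule.span_le]
    rintro _ ⟨g, rfl⟩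
    exact gTT_mem_Vplus g hξ
  · refine Vplus_le_of_mem (fun g v hv => ?_)
      (Submodule.subset_span ⟨1, (LinearMap.congr_fun (map_one steinbergSq) ξ).symm⟩) hξ hξ0
    induction hv using Submodule.span_induction with
    | mem v hv =>
      obtain ⟨g', rfl⟩ := hv
      exact Submodule.subset_span ⟨g * g', (gTT_mul g g' ξ).symm⟩
    | zero => simp
    | add v v' _ _ hv hv' => rw [map_add]; exact add_mem hv hv'
    | smul a v _ hv => rw [map_smul]; exact Submodule.smul_mem _ _ hv
  · by_contra hv0
    exact hWne (le_antisymm hWle (Vplus_le_of_mem hW hv (hWle hv) hv0))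

end SL2X
end
end

section
/- For every n ≥ 1 and all x, y ∈ F_{q^n} with x ≠ y, one has [D_{q^n}]·[U_{q^n}]·ρ_{x,y} = 0 in V₋. -/
noncomputable section

open scoped TensorProduct

namespace SL2X

variable (p : ℕ) [Fact p.Prime]

variable (k : Type) [Field k] [IsAlgClosed k] [CharZero k]

theorem gSt_eps (u x : F p) : gSt p k (eps p u) (E p k x) = E p k (x + u) := by
  apply Subtype.ext
  have hm : eps p u * eps p x = eps p (x + u) := by
    apply Subtype.ext
    change (eps p u).1 * (eps p x).1 = (eps p (x + u)).1
    simp [eps]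
  change γ p k (eps p u) • γ p k (eps p x) • eta p k = γ p k (eps p (x + u)) • eta p k
  rw [← mul_smul, γ, γ, ← map_mul, hm, γ]

theorem h_smul_eta (t : (F p)ˣ) : γ p k (h p t) • eta p k = eta p k := by
  have hgen : ∀ r : (F p)ˣ, γ p k (h p r) - 1 ∈ Nmod p k 1 := fun r =>
    Submodule.subset_span ⟨⟨h p r, show (h p r).1 1 0 = 0 by simp [h]⟩, by simp⟩
  have hm : h p t * sG p = sG p * h p t⁻¹ := by
    apply Subtype.ext
    change (h p t).1 * (sG p).1 = (sG p).1 * (h p t⁻¹).1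
    simp [h, sG]
  have hmγ : γ p k (h p t) * γ p k (sG p) = γ p k (sG p) * γ p k (h p t⁻¹) := by
    simp only [γ, ← map_mul, hm]
  change (Submodule.Quotient.mk (γ p k (h p t) * (1 - γ p k (sG p))) :
    kG p k ⧸ Nmod p k 1) = Submodule.Quotient.mk (1 - γ p k (sG p))
  rw [Submodule.Quotient.eq]
  have key : γ p k (h p t) * (1 - γ p k (sG p)) - (1 - γ p k (sG p)) =
      (γ p k (h p t) - 1) - γ p k (sG p) • (γ p k (h p t⁻¹) - 1) := by
    rw [smul_eq_mul, mul_sub, mul_sub, hmγ]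
    simp only [mul_one]
    abel
  rw [key]
  exact sub_mem (hgen t) (Submodule.smul_mem _ _ (hgen t⁻¹))

theorem gSt_h (t : (F p)ˣ) (x : F p) :
    gSt p k (h p t) (E p k x) = E p k ((t : F p) ^ 2 * x) := by
  apply Subtype.ext
  have hm : h p t * eps p x = eps p ((t : F p) ^ 2 * x) * h p t := by
    apply Subtype.ext
    change (h p t).1 * (eps p x).1 = (eps p ((t : F p) ^ 2 * x)).1 * (h p t).1
    simp [h, eps]
    field_simp
  change γ p k (h p t) • γ p k (eps p x) • eta p k =
    γ p k (eps p ((t : F p) ^ 2 * x)) • eta p k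
  have hmγ : γ p k (h p t) * γ p k (eps p x) =
      γ p k (eps p ((t : F p) ^ 2 * x)) * γ p k (h p t) := by
    simp only [γ, ← map_mul, hm]
  rw [← mul_smul, hmγ, mul_smul, h_smul_eta]

theorem gTT_eps_ρ (u x y : F p) :
    gTT p k (eps p u) (ρ p k x y) = ρ p k (x + u) (y + u) := by
  simp [gTT, ρ, gSt_eps]

theorem gTT_h_ρ (t : (F p)ˣ) (x y : F p) :
    gTT p k (h p t) (ρ p k x y) = ρ p k ((t : F p) ^ 2 * x) ((t : F p) ^ 2 * y) := by
  simp [gTT, ρ, gSt_h]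

theorem ρ_add_swap (x y : F p) : ρ p k x y + ρ p k y x = 0 := by
  rw [ρ, ρ]
  module

open Classical in
/-- Summing `ρ_{a(x+u), a(y+u)}` over `a ≠ 0` and `u` in an additive subgroup gives zero:
`(a, u) ↦ (-a, -(u + x + y))` exchanges the two indices of `ρ`. -/
theorem sum_ρ_eq_zero (H : AddSubgroup (F p)) (S : Finset (F p)) (hS : ∀ z, z ∈ S ↔ z ∈ H)
    {x y : F p} (hx : x ∈ S) (hy : y ∈ S) :
    ∑ a ∈ S.erase 0, ∑ u ∈ S, ρ p k (a * (x + u)) (a * (y + u)) = 0 := by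
  rw [hS] at hx hy
  have hswap : ∑ a ∈ S.erase 0, ∑ u ∈ S, ρ p k (a * (x + u)) (a * (y + u)) =
      ∑ a ∈ S.erase 0, ∑ u ∈ S, ρ p k (a * (y + u)) (a * (x + u)) := by
    refine Finset.sum_nbij' (fun a => -a) (fun a => -a) ?_ ?_ ?_ ?_ ?_
    · intro a; simp [hS]
    · intro a; simp [hS]
    · intro a _; simp
    · intro a _; simp
    · intro a _
      refine Finset.sum_nbij' (fun u => -(u + (x + y))) (fun u => -(u + (x + y))) ?_ ?_ ?_ ?_ ?_
      · intro u hu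
        rw [hS] at hu ⊢
        exact H.neg_mem (H.add_mem hu (H.add_mem hx hy))
      · intro u hu
        rw [hS] at hu ⊢
        exact H.neg_mem (H.add_mem hu (H.add_mem hx hy))
      · intro u _; ring
      · intro u _; ring
      · intro u _
        congr 1 <;> ring
  have h2 : (2 : k) • ∑ a ∈ S.erase 0, ∑ u ∈ S, ρ p k (a * (x + u)) (a * (y + u)) = 0 := by
    rw [two_smul]
    nth_rw 2 [hswap]
    simp only [← Finset.sum_add_distrib, ρ_add_swap, Finset.sum_const_zero]
  exact (smul_eq_zero.mp h2).resolve_left two_ne_zero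

/-- `[D_{q^n}]·[U_{q^n}]·ρ_{x,y} = 0` for all `x ≠ y` in `F_{q^n}`. -/
theorem stmt12 (hp2 : p ≠ 2) (q n : ℕ) (hq : ∃ m : ℕ, 0 < m ∧ q = p ^ m) (hn : 1 ≤ n)
    (Fqn : Finset (F p)) (hFqn : ∀ x : F p, x ∈ Fqn ↔ x ^ q ^ n = x)
    (D : Finset (F p)ˣ)
    (hD : Set.BijOn (fun t : (F p)ˣ => (t : F p) ^ 2) ↑D
      {x : F p | x ^ q ^ n = x ∧ x ≠ 0})
    (x y : F p) (hx : x ∈ Fqn) (hy : y ∈ Fqn) (hxy : x ≠ y) :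
    ∑ t ∈ D, ∑ u ∈ Fqn, gTT p k (h p t) (gTT p k (eps p u) (ρ p k x y)) = 0 := by
  classical
  obtain ⟨m, -, rfl⟩ := hq
  let H : AddSubgroup (F p) :=
    { carrier := {z | z ^ (p ^ m) ^ n = z}
      zero_mem' := zero_pow (pow_ne_zero _ (pow_ne_zero _ (Fact.out : p.Prime).ne_zero))
      add_mem' := by
        intro a b ha hb
        simp only [Set.mem_ofPred_eq] at *
        rw [← pow_mul] at *
        rw [add_pow_char_pow, ha, hb]
      neg_mem' := by
        intro a ha
        simp only [Set.mem_ofPred_eq] at *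
        rw [(((Fact.out : p.Prime).odd_of_ne_two hp2).pow.pow).neg_pow, ha] }
  rw [← sum_ρ_eq_zero p k H Fqn hFqn hx hy]
  refine Finset.sum_nbij (fun t : (F p)ˣ => (t : F p) ^ 2) ?_ hD.injOn ?_ ?_
  · intro t ht
    obtain ⟨h1, h2⟩ := hD.mapsTo ht
    exact Finset.mem_erase.mpr ⟨h2, (hFqn _).mpr h1⟩
  · intro a ha
    obtain ⟨h1, h2⟩ := Finset.mem_erase.mp ha
    exact hD.surjOn ⟨(hFqn _).mp h2, h1⟩
  · intro t _
    simp only [gTT_eps_ρ, gTT_h_ρ]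

end SL2X
end
end
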